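/- (Total correctness of ⟦Q⟧ in the Lolli model.) Let Q be the loop program while ((*1) > 0) do (0 ← *0 + *1 ; 1 ← *1 − 1) of the imperative language ℒ. For all N₁, N₂ ∈ ℕ, every memory M₀, and M = M₀[0↦N₂][1↦N₁], there exists N₃ ∈ ℕ such that the sequent Γ_e ; ⟦M⟧ ⊢ e ⟦Q⟧ ⌜0⌝ ((m ⌜0⌝ ⌜N₃⌝) ⊗ ⊤) is provable in Lolli and N₃ = N₂ + ∑_{i=0}^{N₁} i. -/

import Mathlib

/-- Programs of the imperative language ℒ, which also serve as the closed
terms of type ℝ of the first-order specification language (the homomorphic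
translation `⟦·⟧` via the constructors `v, add, sub, gt, get, set, seq, wh`
is then the identity). -/
inductive Prog : Type
  | num : ℕ → Prog            -- `v N`
  | add : Prog → Prog → Prog
  | sub : Prog → Prog → Prog
  | gt : Prog → Prog → Prog
  | deref : Prog → Prog       -- `get`
  | assign : Prog → Prog → Prog  -- `set`
  | seq : Prog → Prog → Prog
  | whileDo : Prog → Prog → Prog -- `wh`

mutual

/-- Atomic formulas: the memory predicate `m : ℕ → ℕ → o`, the evaluation
predicate `e : ℝ → ℕ → o → o` (whose last argument is a goal formula, the
continuation), and the arithmetic equality/comparison atoms on ℕ. -/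
inductive LAtom : Type
  | m : ℕ → ℕ → LAtom
  | e : Prog → ℕ → LGoal → LAtom
  | eq : ℕ → ℕ → LAtom
  | gt : ℕ → ℕ → LAtom
  | le : ℕ → ℕ → LAtom

/-- Program clause formulas of Lolli over these atoms. -/
inductive LClause : Type
  | atom : LAtom → LClause
  | conj : LClause → LClause → LClause
  | limp : LGoal → LClause → LClause   -- `G ⊸ P`
  | imp  : LGoal → LClause → LClause   -- `G ⇒ P`

/-- Goal formulas of Lolli over these atoms. -/
inductive LGoal : Type
  | top  : LGoal
  | atom : LAtom → LGoal
  | conj : LGoal → LGoal → LGoal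
  | limp : LClause → LGoal → LGoal     -- `P ⊸ G`
  | imp  : LClause → LGoal → LGoal     -- `P ⇒ G`
  | bang : LGoal → LGoal
  | tensor : LGoal → LGoal → LGoal
  | oplus  : LGoal → LGoal → LGoal

end

/-- Provability of the Lolli sequent `Γ ; Δ ⊢ G`.  The arithmetic atoms are
interpreted standardly: a true arithmetic atom is provable (from no bounded
resources). -/
inductive LProv : Set LClause → Multiset LClause → LGoal → Prop
  | id (Γ : Set LClause) (a : LAtom) : LProv Γ {LClause.atom a} (LGoal.atom a)
  | absorb {Γ Δ G} {B : LClause} : B ∈ Γ → LProv Γ (B ::ₘ Δ) G → LProv Γ Δ G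
  | topR (Γ : Set LClause) (Δ : Multiset LClause) : LProv Γ Δ LGoal.top
  | conjL₁ {Γ Δ G} {B₁ B₂ : LClause} :
      LProv Γ (B₁ ::ₘ Δ) G → LProv Γ (LClause.conj B₁ B₂ ::ₘ Δ) G
  | conjL₂ {Γ Δ G} {B₁ B₂ : LClause} :
      LProv Γ (B₂ ::ₘ Δ) G → LProv Γ (LClause.conj B₁ B₂ ::ₘ Δ) G
  | conjR {Γ Δ} {G₁ G₂ : LGoal} :
      LProv Γ Δ G₁ → LProv Γ Δ G₂ → LProv Γ Δ (LGoal.conj G₁ G₂)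
  | limpL {Γ Δ₁ Δ₂ G} {G₁ : LGoal} {B₂ : LClause} :
      LProv Γ Δ₁ G₁ → LProv Γ (B₂ ::ₘ Δ₂) G →
      LProv Γ (LClause.limp G₁ B₂ ::ₘ (Δ₁ + Δ₂)) G
  | limpR {Γ Δ} {B : LClause} {G : LGoal} :
      LProv Γ (B ::ₘ Δ) G → LProv Γ Δ (LGoal.limp B G)
  | impL {Γ Δ G} {G₁ : LGoal} {B₂ : LClause} :
      LProv Γ 0 G₁ → LProv Γ (B₂ ::ₘ Δ) G → LProv Γ (LClause.imp G₁ B₂ ::ₘ Δ) G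
  | impR {Γ Δ} {B : LClause} {G : LGoal} :
      LProv (insert B Γ) Δ G → LProv Γ Δ (LGoal.imp B G)
  | bangR {Γ} {G : LGoal} : LProv Γ 0 G → LProv Γ 0 (LGoal.bang G)
  | oplusR₁ {Γ Δ} {G₁ G₂ : LGoal} : LProv Γ Δ G₁ → LProv Γ Δ (LGoal.oplus G₁ G₂)
  | oplusR₂ {Γ Δ} {G₁ G₂ : LGoal} : LProv Γ Δ G₂ → LProv Γ Δ (LGoal.oplus G₁ G₂)
  | tensorR {Γ Δ₁ Δ₂} {G₁ G₂ : LGoal} :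
      LProv Γ Δ₁ G₁ → LProv Γ Δ₂ G₂ → LProv Γ (Δ₁ + Δ₂) (LGoal.tensor G₁ G₂)
  | eqR {Γ : Set LClause} {n₁ n₂ : ℕ} :
      n₁ = n₂ → LProv Γ 0 (LGoal.atom (LAtom.eq n₁ n₂))
  | gtR {Γ : Set LClause} {n₁ n₂ : ℕ} :
      n₁ > n₂ → LProv Γ 0 (LGoal.atom (LAtom.gt n₁ n₂))
  | leR {Γ : Set LClause} {n₁ n₂ : ℕ} :
      n₁ ≤ n₂ → LProv Γ 0 (LGoal.atom (LAtom.le n₁ n₂))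

/-- The set `Γ_e` of (all instances of the universally closed) program clauses
modeling the evaluation semantics of ℒ; universal quantification over the
variables `E, E₁, E₂ : ℝ`, `N, N₁, N₂, N₃ : ℕ` and `C : o` of each clause is
rendered by taking all of its instances. -/
inductive GammaE : LClause → Prop
  | val (N : ℕ) (C : LGoal) :
      GammaE (LClause.limp C (LClause.atom (LAtom.e (Prog.num N) N C)))
  | add (E₁ E₂ : Prog) (N₁ N₂ N₃ : ℕ) (C : LGoal) :
      GammaE (LClause.limp
        (LGoal.atom (LAtom.e E₁ N₁ (LGoal.atom (LAtom.e E₂ N₂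
          (LGoal.tensor (LGoal.atom (LAtom.eq N₃ (N₁ + N₂))) C)))))
        (LClause.atom (LAtom.e (Prog.add E₁ E₂) N₃ C)))
  | sub (E₁ E₂ : Prog) (N₁ N₂ N₃ : ℕ) (C : LGoal) :
      GammaE (LClause.limp
        (LGoal.atom (LAtom.e E₁ N₁ (LGoal.atom (LAtom.e E₂ N₂
          (LGoal.tensor (LGoal.atom (LAtom.eq N₃ (N₁ - N₂))) C)))))
        (LClause.atom (LAtom.e (Prog.sub E₁ E₂) N₃ C)))
  | gt_true (E₁ E₂ : Prog) (N₁ N₂ : ℕ) (C : LGoal) :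
      GammaE (LClause.limp
        (LGoal.atom (LAtom.e E₁ N₁ (LGoal.atom (LAtom.e E₂ N₂
          (LGoal.tensor (LGoal.atom (LAtom.gt N₁ N₂)) C)))))
        (LClause.atom (LAtom.e (Prog.gt E₁ E₂) 1 C)))
  | gt_false (E₁ E₂ : Prog) (N₁ N₂ : ℕ) (C : LGoal) :
      GammaE (LClause.limp
        (LGoal.atom (LAtom.e E₁ N₁ (LGoal.atom (LAtom.e E₂ N₂
          (LGoal.tensor (LGoal.atom (LAtom.le N₁ N₂)) C)))))
        (LClause.atom (LAtom.e (Prog.gt E₁ E₂) 0 C)))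
  | get (E : Prog) (N₁ N₂ : ℕ) (C : LGoal) :
      GammaE (LClause.limp
        (LGoal.atom (LAtom.e E N₁
          (LGoal.tensor (LGoal.atom (LAtom.m N₁ N₂))
            (LGoal.limp (LClause.atom (LAtom.m N₁ N₂)) C))))
        (LClause.atom (LAtom.e (Prog.deref E) N₂ C)))
  | set (E₁ E₂ : Prog) (N₁ N₂ N₃ : ℕ) (C : LGoal) :
      GammaE (LClause.limp
        (LGoal.atom (LAtom.e E₁ N₁ (LGoal.atom (LAtom.e E₂ N₂
          (LGoal.tensor (LGoal.atom (LAtom.m N₁ N₃))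
            (LGoal.limp (LClause.atom (LAtom.m N₁ N₂)) C))))))
        (LClause.atom (LAtom.e (Prog.assign E₁ E₂) N₂ C)))
  | seq (E₁ E₂ : Prog) (N₁ N₂ : ℕ) (C : LGoal) :
      GammaE (LClause.limp
        (LGoal.atom (LAtom.e E₁ N₁ (LGoal.atom (LAtom.e E₂ N₂ C))))
        (LClause.atom (LAtom.e (Prog.seq E₁ E₂) N₂ C)))
  | wh_true (E₁ E₂ : Prog) (N₁ N₂ : ℕ) (C : LGoal) :
      GammaE (LClause.limp
        (LGoal.tensor
          (LGoal.atom (LAtom.e E₁ N₁ (LGoal.atom (LAtom.e E₂ N₂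
            (LGoal.atom (LAtom.e (Prog.whileDo E₁ E₂) 0 C))))))
          (LGoal.atom (LAtom.gt N₁ 0)))
        (LClause.atom (LAtom.e (Prog.whileDo E₁ E₂) 0 C)))
  | wh_false (E₁ E₂ : Prog) (N₁ : ℕ) (C : LGoal) :
      GammaE (LClause.limp
        (LGoal.tensor (LGoal.atom (LAtom.e E₁ N₁ C))
          (LGoal.atom (LAtom.eq N₁ 0)))
        (LClause.atom (LAtom.e (Prog.whileDo E₁ E₂) 0 C)))

/-- A memory: a partial function from ℕ to ℕ (with finite domain, so that its
translation is a multiset). -/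
def LMem : Type := Finmap fun _ : ℕ => ℕ

/-- The translation `⟦M⟧` of a memory `M`: the multiset `{ m l v : M(l) = v }`. -/
def memT (M : LMem) : Multiset LClause :=
  M.entries.map fun s => LClause.atom (LAtom.m s.1 s.2)

/-- The memory update `M[x ↦ y]`. -/
def LMem.update (M : LMem) (x y : ℕ) : LMem := Finmap.insert x y M

/-- The summation loop `Q = while ((*1) > 0) do (0 ← *0 + *1 ; 1 ← *1 − 1)`
(equivalently, its translation `⟦Q⟧` as a term of type ℝ). -/
def progQ : Prog :=
  Prog.whileDo (Prog.gt (Prog.deref (Prog.num 1)) (Prog.num 0))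
    (Prog.seq
      (Prog.assign (Prog.num 0) (Prog.add (Prog.deref (Prog.num 0)) (Prog.deref (Prog.num 1))))
      (Prog.assign (Prog.num 1) (Prog.sub (Prog.deref (Prog.num 1)) (Prog.num 1))))

namespace LProv

/-- Backchaining on a linear implication from the unbounded context. -/
theorem backchain {Γ : Set LClause} {Δ : Multiset LClause} {G : LGoal} {a : LAtom}
    (h : LClause.limp G (LClause.atom a) ∈ Γ) (hG : LProv Γ Δ G) :
    LProv Γ Δ (LGoal.atom a) := by
  refine absorb h ?_
  simpa using limpL hG (id Γ a)

theorem tensor_of_left {Γ : Set LClause} {Δ : Multiset LClause} {G₁ G₂ : LGoal}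
    (h₁ : LProv Γ 0 G₁) (h₂ : LProv Γ Δ G₂) : LProv Γ Δ (LGoal.tensor G₁ G₂) := by
  simpa using tensorR h₁ h₂

theorem tensor_of_right {Γ : Set LClause} {Δ : Multiset LClause} {G₁ G₂ : LGoal}
    (h₁ : LProv Γ Δ G₁) (h₂ : LProv Γ 0 G₂) : LProv Γ Δ (LGoal.tensor G₁ G₂) := by
  simpa using tensorR h₁ h₂

theorem tensor_atom {Γ : Set LClause} {Δ : Multiset LClause} {a : LAtom} {G : LGoal}
    (h : LProv Γ Δ G) : LProv Γ (LClause.atom a ::ₘ Δ) (LGoal.tensor (LGoal.atom a) G) := by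
  simpa using tensorR (id Γ a) h

section Evaluation

variable {Δ : Multiset LClause} {C : LGoal}

theorem eval_num {n : ℕ} (h : LProv {p | GammaE p} Δ C) :
    LProv {p | GammaE p} Δ (LGoal.atom (LAtom.e (Prog.num n) n C)) :=
  backchain (GammaE.val n C) h

theorem eval_deref_num {l n : ℕ}
    (h : LProv {p | GammaE p} (LClause.atom (LAtom.m l n) ::ₘ Δ) C) :
    LProv {p | GammaE p} (LClause.atom (LAtom.m l n) ::ₘ Δ)
      (LGoal.atom (LAtom.e (Prog.deref (Prog.num l)) n C)) :=
  backchain (GammaE.get _ l n C) (eval_num (tensor_atom (limpR h)))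

/-- The guard `*1 > 0` evaluates to `1` when cell `1` holds a positive number. -/
theorem eval_guard_of_pos {b : ℕ} (hb : 0 < b)
    (h : LProv {p | GammaE p} (LClause.atom (LAtom.m 1 b) ::ₘ Δ) C) :
    LProv {p | GammaE p} (LClause.atom (LAtom.m 1 b) ::ₘ Δ)
      (LGoal.atom (LAtom.e (Prog.gt (Prog.deref (Prog.num 1)) (Prog.num 0)) 1 C)) :=
  backchain (GammaE.gt_true _ _ b 0 C)
    (eval_deref_num (eval_num (tensor_of_left (gtR hb) h)))

/-- The guard `*1 > 0` evaluates to `0` when cell `1` holds zero. -/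
theorem eval_guard_of_zero
    (h : LProv {p | GammaE p} (LClause.atom (LAtom.m 1 0) ::ₘ Δ) C) :
    LProv {p | GammaE p} (LClause.atom (LAtom.m 1 0) ::ₘ Δ)
      (LGoal.atom (LAtom.e (Prog.gt (Prog.deref (Prog.num 1)) (Prog.num 0)) 0 C)) :=
  backchain (GammaE.gt_false _ _ 0 0 C)
    (eval_deref_num (eval_num (tensor_of_left (leR le_rfl) h)))

/-- The assignment `0 ← *0 + *1`. -/
theorem eval_accumulate {a b : ℕ}
    (h : LProv {p | GammaE p}
      (LClause.atom (LAtom.m 1 b) ::ₘ LClause.atom (LAtom.m 0 (a + b)) ::ₘ Δ) C) :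
    LProv {p | GammaE p} (LClause.atom (LAtom.m 1 b) ::ₘ LClause.atom (LAtom.m 0 a) ::ₘ Δ)
      (LGoal.atom (LAtom.e (Prog.assign (Prog.num 0)
        (Prog.add (Prog.deref (Prog.num 0)) (Prog.deref (Prog.num 1)))) (a + b) C)) := by
  refine backchain (GammaE.set _ _ 0 (a + b) a C) (eval_num ?_)
  refine backchain (GammaE.add _ _ a b _ _) ?_
  rw [Multiset.cons_swap]
  refine eval_deref_num ?_
  rw [Multiset.cons_swap]
  refine eval_deref_num (tensor_of_left (eqR rfl) ?_)
  rw [Multiset.cons_swap]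
  refine tensor_atom (limpR ?_)
  rwa [Multiset.cons_swap]

/-- The assignment `1 ← *1 − 1`. -/
theorem eval_decrement {b : ℕ}
    (h : LProv {p | GammaE p} (LClause.atom (LAtom.m 1 (b - 1)) ::ₘ Δ) C) :
    LProv {p | GammaE p} (LClause.atom (LAtom.m 1 b) ::ₘ Δ)
      (LGoal.atom (LAtom.e (Prog.assign (Prog.num 1)
        (Prog.sub (Prog.deref (Prog.num 1)) (Prog.num 1))) (b - 1) C)) :=
  backchain (GammaE.set _ _ 1 (b - 1) b C) <| eval_num <|
    backchain (GammaE.sub _ _ b 1 _ _) <| eval_deref_num <| eval_num <|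
      tensor_of_left (eqR rfl) (tensor_atom (limpR h))

/-- Started with `a` in cell `0` and `b` in cell `1`, the summation loop terminates with
`a + ∑ i ≤ b, i` in cell `0` and zero in cell `1`. -/
theorem eval_progQ {a b : ℕ}
    (h : LProv {p | GammaE p} (LClause.atom (LAtom.m 1 0) ::ₘ
      LClause.atom (LAtom.m 0 (a + ∑ i ∈ Finset.range (b + 1), i)) ::ₘ Δ) C) :
    LProv {p | GammaE p} (LClause.atom (LAtom.m 1 b) ::ₘ LClause.atom (LAtom.m 0 a) ::ₘ Δ)
      (LGoal.atom (LAtom.e progQ 0 C)) := by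
  induction b generalizing a with
  | zero =>
    exact backchain (GammaE.wh_false _ _ 0 C)
      (tensor_of_right (eval_guard_of_zero (by simpa using h)) (eqR rfl))
  | succ b ih =>
    refine backchain (GammaE.wh_true _ _ 1 b C)
      (tensor_of_right (eval_guard_of_pos b.succ_pos ?_) (gtR one_pos))
    refine backchain (GammaE.seq _ _ (a + (b + 1)) b _) (eval_accumulate ?_)
    refine eval_decrement (b := b + 1) (ih ?_)
    rwa [Finset.sum_range_succ, add_comm (∑ i ∈ _, i), ← add_assoc] at h

end Evaluation

end LProv

theorem exists_memT_update_update (M : LMem) {x y : ℕ} (hxy : x ≠ y) (a b : ℕ) :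
    ∃ Δ, memT ((M.update x a).update y b) =
      LClause.atom (LAtom.m y b) ::ₘ LClause.atom (LAtom.m x a) ::ₘ Δ := by
  induction M using Finmap.induction_on with
  | H s =>
    refine ⟨Multiset.map (fun s : Sigma fun _ : ℕ => ℕ => LClause.atom (LAtom.m s.1 s.2))
      (List.kerase y (List.kerase x s.entries) : List (Sigma fun _ : ℕ => ℕ)), ?_⟩
    simp [memT, LMem.update, Finmap.insert_toFinmap, AList.toFinmap_entries,
      AList.entries_insert, List.kerase_cons_ne (β := fun _ => ℕ) (s := ⟨x, a⟩) hxy.symm]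

/-- **Total correctness of `⟦Q⟧` in the Lolli model**: for all `N₁, N₂ ∈ ℕ`,
every memory `M₀` and `M = M₀[0↦N₂][1↦N₁]`, there is an `N₃ ∈ ℕ` such that the
sequent `Γ_e ; ⟦M⟧ ⊢ e ⟦Q⟧ ⌜0⌝ ((m ⌜0⌝ ⌜N₃⌝) ⊗ ⊤)` is provable in Lolli and
`N₃ = N₂ + ∑_{i=0}^{N₁} i`. -/
theorem progQ_total_correctness_model (N₁ N₂ : ℕ) (M₀ : LMem) :
    ∃ N₃ : ℕ,
      LProv {p | GammaE p} (memT ((M₀.update 0 N₂).update 1 N₁))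
        (LGoal.atom (LAtom.e progQ 0
          (LGoal.tensor (LGoal.atom (LAtom.m 0 N₃)) LGoal.top))) ∧
      N₃ = N₂ + ∑ i ∈ Finset.range (N₁ + 1), i := by
  obtain ⟨Δ, hΔ⟩ := exists_memT_update_update M₀ zero_ne_one N₂ N₁
  refine ⟨_, ?_, rfl⟩
  rw [hΔ]
  refine LProv.eval_progQ ?_
  rw [Multiset.cons_swap]
  exact LProv.tensor_atom (LProv.topR _ _)
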